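/- For n ≥ 2, the independence complex of X_n^{(2)} is homotopy equivalent to the double suspension of Ind(X_{n-2}^{(2)}): Ind(X_{n+1}^{(2)}) ≃ Σ²(Ind(X_{n-1}^{(2)})) for all n ≥ 2, with base case Ind(X_1^{(2)}) ≃ S^0. -/

import Mathlib

open Function Set

/-- A set of vertices of a simple graph is independent if its elements are
pairwise non-adjacent.  The independence complex `Ind G` is the simplicial
complex whose faces are exactly the independent sets. -/
def isIndepSet {V : Type*} (G : SimpleGraph V) (s : Set V) : Prop :=
  s.Pairwise fun a b => ¬ G.Adj a b

/-- Geometric realization of the subcomplex of the independence complex of `G`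
consisting of the independent sets contained in `S` (so `S = univ` gives
`Ind G`, `S = {v}ᶜ` gives `Ind (G \ v)`, and `S = N[v]ᶜ` gives
`Ind (G \ N[v])`): convex combinations of vertices whose support is a face. -/
def indRealizationIn {V : Type*} (G : SimpleGraph V) (S : Set V) : Set (V → ℝ) :=
  {f | (∀ v, 0 ≤ f v) ∧ (Function.support f).Finite ∧ Function.support f ⊆ S ∧
       isIndepSet G (Function.support f) ∧ ∑ᶠ v, f v = 1}

/-- Geometric realization of the independence complex `Ind G`. -/
def indRealization {V : Type*} (G : SimpleGraph V) : Set (V → ℝ) :=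
  indRealizationIn G Set.univ

/-- The (unreduced) suspension of a topological space. -/
def Susp (X : Type*) [TopologicalSpace X] : Type _ :=
  Quot (fun p q : X × unitInterval => (p.2 = 0 ∧ q.2 = 0) ∨ (p.2 = 1 ∧ q.2 = 1))

instance (X : Type*) [TopologicalSpace X] : TopologicalSpace (Susp X) :=
  inferInstanceAs (TopologicalSpace (Quot _))

/-- The wedge of two pointed topological spaces. -/
def WedgeAt (X Y : Type*) [TopologicalSpace X] [TopologicalSpace Y] (x₀ : X) (y₀ : Y) :
    Type _ :=
  Quot (fun p q : X ⊕ Y => p = Sum.inl x₀ ∧ q = Sum.inr y₀)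

instance (X Y : Type*) [TopologicalSpace X] [TopologicalSpace Y] (x₀ : X) (y₀ : Y) :
    TopologicalSpace (WedgeAt X Y x₀ y₀) :=
  inferInstanceAs (TopologicalSpace (Quot _))

/-- The sphere `S^{m-1}`, realized as the unit sphere of `ℝ^m`. -/
def sphere' (m : ℕ) : Set (EuclideanSpace ℝ (Fin m)) := Metric.sphere 0 1

/-- A wedge of two `m`-dimensional spheres: the two unit spheres of `ℝ^{m+1}`
centered at `±e₀`, which are tangent at the origin. -/
def sphereWedge (m : ℕ) : Set (EuclideanSpace ℝ (Fin (m + 1))) :=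
  {x | dist x (EuclideanSpace.single (0 : Fin (m + 1)) (1 : ℝ)) = 1 ∨
       dist x (-(EuclideanSpace.single (0 : Fin (m + 1)) (1 : ℝ))) = 1}

/-- The hexagonal line tiling graph `H_{1×1×n}`: two rows (row `j` carries the
vertices `v^{j+1}_1, …, v^{j+1}_{2n+1}`, column `i : Fin (2n+1)` being the
1-indexed vertex `v^{j+1}_{i+1}`), each row forming a path, together with the
rung edges `{v^1_{2t-1}, v^2_{2t-1}}`, i.e. rungs at even 0-indexed columns. -/
def hexRow (n : ℕ) : SimpleGraph (Fin 2 × Fin (2 * n + 1)) :=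
  SimpleGraph.fromRel (fun p q =>
    (p.1 = q.1 ∧ (p.2 : ℕ) + 1 = (q.2 : ℕ)) ∨
    (p.1 ≠ q.1 ∧ p.2 = q.2 ∧ (p.2 : ℕ) % 2 = 0))

/-- The last vertex `v^1_{2n+1}` of the top row of `H_{1×1×n}`. -/
def hexTop (n : ℕ) : Fin 2 × Fin (2 * n + 1) := (0, ⟨2 * n, by omega⟩)

/-- `X_n^{(1)} = H_{1×1×n} \ {v^1_{2n+1}}` : realization of its independence
complex, as the subcomplex of `Ind (H_{1×1×n})` of faces avoiding `v^1_{2n+1}`. -/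
def Xn1 (n : ℕ) : Set (Fin 2 × Fin (2 * n + 1) → ℝ) :=
  indRealizationIn (hexRow n) ({hexTop n}ᶜ)

/-- `X_n^{(2)} = H_{1×1×n} \ N[v^1_{2n+1}]` : realization of its independence
complex, as the subcomplex of `Ind (H_{1×1×n})` of faces avoiding `N[v^1_{2n+1}]`. -/
def Xn2 (n : ℕ) : Set (Fin 2 × Fin (2 * n + 1) → ℝ) :=
  indRealizationIn (hexRow n) ((insert (hexTop n) ((hexRow n).neighborSet (hexTop n)))ᶜ)



open Topology

theorem mem_indR {V : Type*} [Fintype V] (G : SimpleGraph V) (S : Set V) (f : V → ℝ) :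
    f ∈ indRealizationIn G S ↔ (∀ v, 0 ≤ f v) ∧ (∀ v, v ∉ S → f v = 0) ∧
      (∀ a b, G.Adj a b → f a = 0 ∨ f b = 0) ∧ ∑ v, f v = 1 := by
  unfold indRealizationIn isIndepSet
  simp only [mem_setOf_eq, finsum_eq_sum_of_fintype]
  refine and_congr_right fun _ => ?_
  constructor
  · rintro ⟨_, h1, h2, h3⟩
    refine ⟨fun v hv => ?_, fun a b hab => ?_, h3⟩
    · by_contra h
      exact hv (h1 h)
    · by_contra! h
      exact h2 h.1 h.2 hab.ne hab
  · rintro ⟨h1, h2, h3⟩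
    refine ⟨Set.toFinite _, fun v hv => ?_, fun a ha b hb _ hab => ?_, h3⟩
    · by_contra h
      exact hv (h1 v h)
    · rcases h2 a b hab with h | h
      · exact ha h
      · exact hb h

theorem indR_compact {V : Type*} [Fintype V] (G : SimpleGraph V) (S : Set V) :
    IsCompact (indRealizationIn G S) := by
  have hc : IsCompact (Set.Icc (0 : V → ℝ) 1) := isCompact_Icc
  refine hc.of_isClosed_subset ?_ ?_
  · have : indRealizationIn G S = {f | (∀ v, 0 ≤ f v) ∧ (∀ v, v ∉ S → f v = 0) ∧
      (∀ a b, G.Adj a b → f a = 0 ∨ f b = 0) ∧ ∑ v, f v = 1} := by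
      ext f; exact mem_indR G S f
    rw [this]
    simp only [setOf_and, setOf_forall, setOf_or]
    refine IsClosed.inter ?_ (IsClosed.inter ?_ (IsClosed.inter ?_ ?_))
    · exact isClosed_iInter fun v => isClosed_le continuous_const (continuous_apply v)
    · exact isClosed_iInter fun v => isClosed_iInter fun _ =>
        isClosed_eq (continuous_apply v) continuous_const
    · exact isClosed_iInter fun a => isClosed_iInter fun b => isClosed_iInter fun _ =>
        (isClosed_eq (continuous_apply a) continuous_const).union
          (isClosed_eq (continuous_apply b) continuous_const)
    · exact isClosed_eq (continuous_finsetSum _ fun v _ => continuous_apply v) continuous_const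
  · intro f hf
    rw [mem_indR] at hf
    refine ⟨fun v => hf.1 v, fun v => ?_⟩
    have := Finset.single_le_sum (f := f) (fun i _ => hf.1 i) (Finset.mem_univ v)
    rw [hf.2.2.2] at this
    simpa using this

/-- Straight-line homotopy inside a subset. -/
theorem lineHomotopic {V : Type*} {A : Set (V → ℝ)} {X : Type*} [TopologicalSpace X]
    (f g : C(X, A))
    (h : ∀ x (t : ℝ), 0 ≤ t → t ≤ 1 → (1 - t) • (f x : V → ℝ) + t • (g x : V → ℝ) ∈ A) :
    ContinuousMap.Homotopic f g := by
  refine ⟨⟨⟨fun p => ⟨(1 - (p.1 : ℝ)) • (f p.2 : V → ℝ) + (p.1 : ℝ) • (g p.2 : V → ℝ),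
    h _ _ p.1.2.1 p.1.2.2⟩, ?_⟩, ?_, ?_⟩⟩
  · refine Continuous.subtype_mk ?_ _
    fun_prop
  · intro x; ext1; simp
  · intro x; ext1; simp

/-- Functoriality of the suspension. -/
def suspMap {X Y : Type*} [TopologicalSpace X] [TopologicalSpace Y] (f : C(X, Y)) :
    C(Susp X, Susp Y) where
  toFun := Quot.map (fun p => (f p.1, p.2)) (fun _ _ h => h)
  continuous_toFun := by
    refine continuous_quot_lift _ ?_
    refine continuous_quot_mk.comp ?_
    fun_prop

theorem suspMap_homotopic {X Y : Type*} [TopologicalSpace X] [TopologicalSpace Y]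
    {f g : C(X, Y)} (h : ContinuousMap.Homotopic f g) :
    ContinuousMap.Homotopic (suspMap f) (suspMap g) := by
  obtain ⟨H⟩ := h
  refine ⟨⟨⟨fun p => Quot.map (fun z : X × unitInterval => (H (p.1, z.1), z.2))
    (fun _ _ h => h) p.2, ?_⟩, ?_, ?_⟩⟩
  · have hq : IsQuotientMap (Quot.mk (fun p q : X × unitInterval =>
        (p.2 = 0 ∧ q.2 = 0) ∨ (p.2 = 1 ∧ q.2 = 1))) := isQuotientMap_quot_mk
    refine hq.continuous_lift_prod_right ?_
    change Continuous fun p : unitInterval × (X × unitInterval) =>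
      (Quot.mk _ (H (p.1, p.2.1), p.2.2) : Susp Y)
    refine continuous_quot_mk.comp ?_
    fun_prop
  · rintro ⟨x⟩
    change Quot.mk _ (H (0, x.1), x.2) = Quot.mk _ (f x.1, x.2)
    rw [H.apply_zero]
  · rintro ⟨x⟩
    change Quot.mk _ (H (1, x.1), x.2) = Quot.mk _ (g x.1, x.2)
    rw [H.apply_one]

theorem suspMap_comp {X Y Z : Type*} [TopologicalSpace X] [TopologicalSpace Y]
    [TopologicalSpace Z] (g : C(Y, Z)) (f : C(X, Y)) :
    suspMap (g.comp f) = (suspMap g).comp (suspMap f) := by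
  ext x
  rcases x with ⟨x⟩
  rfl

theorem suspMap_id {X : Type*} [TopologicalSpace X] :
    suspMap (ContinuousMap.id X) = ContinuousMap.id _ := by
  ext x
  rcases x with ⟨x⟩
  rfl

def suspEquiv {X Y : Type*} [TopologicalSpace X] [TopologicalSpace Y]
    (e : ContinuousMap.HomotopyEquiv X Y) :
    ContinuousMap.HomotopyEquiv (Susp X) (Susp Y) where
  toFun := suspMap e.toFun
  invFun := suspMap e.invFun
  left_inv := by
    rw [← suspMap_comp, ← suspMap_id]; exact suspMap_homotopic e.left_inv
  right_inv := by
    rw [← suspMap_comp, ← suspMap_id]; exact suspMap_homotopic e.right_inv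

section fold
open Classical in
/-- The fold map: all mass on the neighbours of `q` is moved to `p`. -/
noncomputable def foldFun {V : Type*} [Fintype V] (G : SimpleGraph V) (p q : V) (f : V → ℝ) :
    V → ℝ :=
  fun v => (if v = p then ∑ w, (if G.Adj q w then f w else 0) else 0) +
    (if G.Adj q v then 0 else f v)

theorem foldFun_continuous {V : Type*} [Fintype V] (G : SimpleGraph V) (p q : V) :
    Continuous (foldFun G p q) := by
  classical
  unfold foldFun
  refine continuous_pi fun v => Continuous.add ?_ ?_
  · split_ifs
    · refine continuous_finsetSum _ fun w _ => ?_
      split_ifs <;> fun_prop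
    · fun_prop
  · split_ifs <;> fun_prop

theorem foldFun_mem {V : Type*} [Fintype V] (G : SimpleGraph V) (S : Set V) (p q : V)
    (hp : p ∈ S) (hpq : G.Adj p q) (hN : ∀ w ∈ S, G.Adj p w → w = q)
    (f : V → ℝ) (hf : f ∈ indRealizationIn G S) (t : ℝ) (h0 : 0 ≤ t) (h1 : t ≤ 1) :
    (1 - t) • f + t • foldFun G p q f ∈ indRealizationIn G S := by
  classical
  rw [mem_indR] at hf ⊢
  obtain ⟨f0, fS, fI, f1⟩ := hf
  have hA : 0 ≤ ∑ w, (if G.Adj q w then f w else 0) :=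
    Finset.sum_nonneg fun w _ => by split_ifs <;> simp [f0]
  have hnn : ∀ v, 0 ≤ foldFun G p q f v := by
    intro v
    unfold foldFun
    refine add_nonneg ?_ ?_
    · split_ifs
      · exact hA
      · exact le_rfl
    · split_ifs
      · exact le_rfl
      · exact f0 v
  have hz : ∀ v, v ≠ p → f v = 0 → foldFun G p q f v = 0 := by
    intro v hv h
    unfold foldFun
    simp [hv, h]
  have hpz : f q ≠ 0 → foldFun G p q f p = 0 := by
    intro h
    have : ∀ w, G.Adj q w → f w = 0 := fun w hw => (fI q w hw).resolve_left h
    unfold foldFun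
    simp only [if_true, hpq.symm, add_zero]
    refine Finset.sum_eq_zero fun w _ => ?_
    split_ifs with hw
    · exact this w hw
    · rfl
  have hsum : ∑ v, foldFun G p q f v = 1 := by
    unfold foldFun
    rw [Finset.sum_add_distrib, Finset.sum_ite_eq' Finset.univ p, ← f1]
    simp only [Finset.mem_univ, if_true]
    rw [← Finset.sum_add_distrib]
    refine Finset.sum_congr rfl fun v _ => ?_
    split_ifs <;> simp
  have key : ∀ b, G.Adj p b → f p = 0 ∧ foldFun G p q f p = 0 ∨
      f b = 0 ∧ foldFun G p q f b = 0 := by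
    intro b hb
    by_cases hbS : b ∈ S
    · obtain rfl := hN b hbS hb
      by_cases hq : f b = 0
      · exact Or.inr ⟨hq, hz b hb.ne' hq⟩
      · exact Or.inl ⟨(fI p b hb).resolve_right hq, hpz hq⟩
    · exact Or.inr ⟨fS b hbS, hz b hb.ne' (fS b hbS)⟩
  have key2 : ∀ a b, G.Adj a b → f a = 0 ∧ foldFun G p q f a = 0 ∨
      f b = 0 ∧ foldFun G p q f b = 0 := by
    intro a b hab
    by_cases ha : a = p
    · subst ha; exact key b hab
    by_cases hb : b = p
    · subst hb; exact (key a hab.symm).symm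
    rcases fI a b hab with h | h
    · exact Or.inl ⟨h, hz a ha h⟩
    · exact Or.inr ⟨h, hz b hb h⟩
  refine ⟨fun v => ?_, fun v hv => ?_, fun a b hab => ?_, ?_⟩
  · have := f0 v
    have := hnn v
    simp only [Pi.add_apply, Pi.smul_apply, smul_eq_mul]
    have : 0 ≤ 1 - t := by linarith
    positivity
  · have hvp : v ≠ p := fun h => hv (h ▸ hp)
    simp [fS v hv, hz v hvp (fS v hv)]
  · rcases key2 a b hab with ⟨h, h'⟩ | ⟨h, h'⟩
    · left; simp [h, h']
    · right; simp [h, h']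
  · simp only [Pi.add_apply, Pi.smul_apply, smul_eq_mul]
    rw [Finset.sum_add_distrib, ← Finset.mul_sum, ← Finset.mul_sum, f1, hsum]
    ring

theorem foldEquiv {V : Type*} [Fintype V] (G : SimpleGraph V) (S : Set V) (p q : V)
    (hp : p ∈ S) (hpq : G.Adj p q) (hN : ∀ w ∈ S, G.Adj p w → w = q) :
    Nonempty (ContinuousMap.HomotopyEquiv (indRealizationIn G S)
      (indRealizationIn G {v | v ∈ S ∧ (v = p ∨ ¬ G.Adj q v)})) := by
  classical
  have hsub : indRealizationIn G {v | v ∈ S ∧ (v = p ∨ ¬ G.Adj q v)} ⊆ indRealizationIn G S := by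
    intro f hf
    rw [mem_indR] at hf ⊢
    exact ⟨hf.1, fun v hv => hf.2.1 v fun h => hv h.1, hf.2.2⟩
  have hr : ∀ f ∈ indRealizationIn G S,
      foldFun G p q f ∈ indRealizationIn G {v | v ∈ S ∧ (v = p ∨ ¬ G.Adj q v)} := by
    intro f hf
    have := foldFun_mem G S p q hp hpq hN f hf 1 zero_le_one le_rfl
    simp only [sub_self, zero_smul, zero_add, one_smul] at this
    rw [mem_indR] at this ⊢
    refine ⟨this.1, fun v hv => ?_, this.2.2⟩
    by_cases hvS : v ∈ S
    · simp only [mem_setOf_eq, not_and, not_or, not_not] at hv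
      obtain ⟨h1, h2⟩ := hv hvS
      simp [foldFun, h1, h2]
    · exact this.2.1 v hvS
  let r : C(indRealizationIn G S, indRealizationIn G {v | v ∈ S ∧ (v = p ∨ ¬ G.Adj q v)}) :=
    ⟨fun f => ⟨foldFun G p q f.1, hr _ f.2⟩,
      ((foldFun_continuous G p q).comp continuous_subtype_val).subtype_mk _⟩
  let i : C(indRealizationIn G {v | v ∈ S ∧ (v = p ∨ ¬ G.Adj q v)}, indRealizationIn G S) :=
    ⟨Set.inclusion hsub, continuous_inclusion hsub⟩
  refine ⟨⟨r, i, ?_, ?_⟩⟩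
  · symm
    refine lineHomotopic _ _ fun f t h0 h1 => ?_
    exact foldFun_mem G S p q hp hpq hN f.1 f.2 t h0 h1
  · have : r.comp i = ContinuousMap.id _ := by
      ext f v
      change foldFun G p q f.1 v = f.1 v
      have hf := (mem_indR _ _ _).1 f.2
      have h0 : ∀ w, w ≠ p → G.Adj q w → f.1 w = 0 := by
        intro w h1 h2
        refine hf.2.1 w ?_
        simp [h1, h2]
      have hs : ∑ w, (if G.Adj q w then f.1 w else 0) = f.1 p := by
        rw [Finset.sum_eq_single p]
        · simp [hpq.symm]
        · intro w _ hw
          split_ifs with h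
          · exact h0 w hw h
          · rfl
        · simp
      unfold foldFun
      rw [hs]
      by_cases hv : v = p
      · subst hv; simp [hpq.symm]
      · by_cases h : G.Adj q v
        · simp [hv, h, h0 v hv h]
        · simp [hv, h]
    rw [this]

open Classical in
/-- The parametrization of the join with `{p, q}` by the suspension. -/
noncomputable def joinFun {V : Type*} (p q : V) (x : V → ℝ) (t : ℝ) : V → ℝ :=
  fun v => if v = p then max 0 (1 - 2 * t) else if v = q then max 0 (2 * t - 1)
    else (1 - |1 - 2 * t|) * x v

theorem sum_split {V : Type*} [Fintype V] [DecidableEq V] {p q : V} (hpq : p ≠ q) (f : V → ℝ) :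
    ∑ v, f v = f p + f q + ∑ v, (if v = p then 0 else if v = q then 0 else f v) := by
  have : ∀ v, f v = (if v = p then f p else 0) + (if v = q then f q else 0) +
      (if v = p then 0 else if v = q then 0 else f v) := by
    intro v
    by_cases h : v = p
    · subst h; simp [hpq]
    · by_cases h' : v = q
      · subst h'; simp [h]
      · simp [h, h']
  rw [Finset.sum_congr rfl fun v _ => this v, Finset.sum_add_distrib, Finset.sum_add_distrib]
  simp

theorem joinFun_mem {V : Type*} [Fintype V] (G : SimpleGraph V) (S : Set V) (p q : V)
    (hp : p ∈ S) (hq : q ∈ S) (hpq : G.Adj p q) (hN : ∀ w ∈ S, G.Adj p w → w = q)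
    (x : V → ℝ) (hx : x ∈ indRealizationIn G {v | v ∈ S ∧ v ≠ p ∧ v ≠ q ∧ ¬ G.Adj q v})
    (t : ℝ) (h0 : 0 ≤ t) (h1 : t ≤ 1) :
    joinFun p q x t ∈ indRealizationIn G {v | v ∈ S ∧ (v = p ∨ ¬ G.Adj q v)} := by
  classical
  rw [mem_indR] at hx ⊢
  obtain ⟨x0, xS, xI, x1⟩ := hx
  have habs : 0 ≤ 1 - |1 - 2 * t| := by
    have : |1 - 2 * t| ≤ 1 := abs_le.2 ⟨by linarith, by linarith⟩
    linarith
  have hxp : x p = 0 := xS p (by simp)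
  have hxq : x q = 0 := xS q (by simp)
  have hz : ∀ v, v ≠ p → v ≠ q → x v = 0 → joinFun p q x t v = 0 := by
    intro v a b c; simp [joinFun, a, b, c]
  have hP : joinFun p q x t p = max 0 (1 - 2 * t) := by simp [joinFun]
  have hQ : joinFun p q x t q = max 0 (2 * t - 1) := by simp [joinFun, hpq.ne']
  have kpq : joinFun p q x t p = 0 ∨ joinFun p q x t q = 0 := by
    rw [hP, hQ]
    rcases le_total (2 * t) 1 with h | h
    · right; exact max_eq_left (by linarith)
    · left; exact max_eq_left (by linarith)
  have kp : ∀ b, G.Adj p b → joinFun p q x t p = 0 ∨ joinFun p q x t b = 0 := by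
    intro b hb
    by_cases hbq : b = q
    · subst hbq; exact kpq
    · right
      refine hz b hb.ne' hbq (xS b ?_)
      intro h
      exact hbq (hN b h.1 hb)
  have kq : ∀ b, G.Adj q b → joinFun p q x t q = 0 ∨ joinFun p q x t b = 0 := by
    intro b hb
    by_cases hbp : b = p
    · subst hbp; exact kpq.symm
    · right
      refine hz b hbp hb.ne' (xS b ?_)
      intro h
      exact h.2.2.2 hb
  refine ⟨fun v => ?_, fun v hv => ?_, fun a b hab => ?_, ?_⟩
  · unfold joinFun
    split_ifs
    · exact le_max_left _ _
    · exact le_max_left _ _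
    · exact mul_nonneg habs (x0 v)
  · have hvp : v ≠ p := by rintro rfl; exact hv ⟨hp, Or.inl rfl⟩
    have hvq : v ≠ q := by rintro rfl; exact hv ⟨hq, Or.inr (G.irrefl)⟩
    refine hz v hvp hvq (xS v fun h => hv ⟨h.1, Or.inr h.2.2.2⟩)
  · by_cases ha : a = p
    · subst ha; exact kp b hab
    by_cases ha' : a = q
    · subst ha'; exact kq b hab
    by_cases hb : b = p
    · subst hb; exact (kp a hab.symm).symm
    by_cases hb' : b = q
    · subst hb'; exact (kq a hab.symm).symm
    rcases xI a b hab with h | h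
    · exact Or.inl (hz a ha ha' h)
    · exact Or.inr (hz b hb hb' h)
  · rw [sum_split hpq.ne, hP, hQ]
    have : ∀ v, (if v = p then 0 else if v = q then 0 else joinFun p q x t v) =
        (1 - |1 - 2 * t|) * x v := by
      intro v
      by_cases h : v = p
      · subst h; simp [hxp]
      · by_cases h' : v = q
        · subst h'; simp [hxq]
        · simp [h, h', joinFun]
    rw [Finset.sum_congr rfl fun v _ => this v, ← Finset.mul_sum, x1]
    rcases le_total (2 * t) 1 with h | h
    · rw [max_eq_right (by linarith), max_eq_left (by linarith), abs_of_nonneg (by linarith)]; ring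
    · rw [max_eq_left (by linarith), max_eq_right (by linarith), abs_of_nonpos (by linarith)]; ring

theorem joinHomeo {V : Type*} [Fintype V] (G : SimpleGraph V) (S : Set V) (p q : V)
    (hp : p ∈ S) (hq : q ∈ S) (hpq : G.Adj p q) (hN : ∀ w ∈ S, G.Adj p w → w = q)
    (hne : (indRealizationIn G {v | v ∈ S ∧ v ≠ p ∧ v ≠ q ∧ ¬ G.Adj q v}).Nonempty) :
    Nonempty (Susp (indRealizationIn G {v | v ∈ S ∧ v ≠ p ∧ v ≠ q ∧ ¬ G.Adj q v}) ≃ₜ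
      indRealizationIn G {v | v ∈ S ∧ (v = p ∨ ¬ G.Adj q v)}) := by
  classical
  set T : Set V := {v | v ∈ S ∧ v ≠ p ∧ v ≠ q ∧ ¬ G.Adj q v} with hT
  set S' : Set V := {v | v ∈ S ∧ (v = p ∨ ¬ G.Adj q v)} with hS'
  have hqp : q ≠ p := hpq.ne'
  let F₀ : indRealizationIn G T × unitInterval → indRealizationIn G S' := fun z =>
    ⟨joinFun p q z.1.1 z.2.1, joinFun_mem G S p q hp hq hpq hN _ z.1.2 _ z.2.2.1 z.2.2.2⟩
  have hF₀ : Continuous F₀ := by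
    refine Continuous.subtype_mk ?_ _
    refine continuous_pi fun v => ?_
    unfold joinFun
    split_ifs
    · fun_prop
    · fun_prop
    · have : Continuous fun z : indRealizationIn G T × unitInterval => z.1.1 v :=
        (continuous_apply v).comp (continuous_subtype_val.comp continuous_fst)
      fun_prop
  let F : Susp (indRealizationIn G T) → indRealizationIn G S' := Quot.lift F₀ (by
    rintro ⟨x, t⟩ ⟨y, s⟩ h
    apply Subtype.ext
    change joinFun p q x.1 t.1 = joinFun p q y.1 s.1
    rcases h with ⟨h, h'⟩ | ⟨h, h'⟩
    · simp only at h h'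
      subst h h'
      funext v; simp [joinFun]
    · simp only at h h'
      subst h h'
      funext v
      have : |(1 : ℝ) - 2| = 1 := by norm_num
      simp [joinFun, this])
  have hF : Continuous F := continuous_quot_lift _ hF₀
  have hval : ∀ z, F (Quot.mk _ z) = F₀ z := fun _ => rfl
  have hpv : ∀ z, (F₀ z).1 p = max 0 (1 - 2 * z.2.1) := by intro z; simp [F₀, joinFun]
  have hqv : ∀ z, (F₀ z).1 q = max 0 (2 * z.2.1 - 1) := by intro z; simp [F₀, joinFun, hqp]
  have hvv : ∀ z v, v ≠ p → v ≠ q → (F₀ z).1 v = (1 - |1 - 2 * z.2.1|) * z.1.1 v := by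
    intro z v h h'; simp [F₀, joinFun, h, h']
  have hinj : Function.Injective F := by
    rintro ⟨z⟩ ⟨w⟩ h
    rw [hval, hval] at h
    have ht : z.2.1 = w.2.1 := by
      have e1 := hpv z
      have e2 := hqv z
      rw [h, hpv] at e1
      rw [h, hqv] at e2
      rcases le_total (2 * z.2.1) 1 with a | a <;> rcases le_total (2 * w.2.1) 1 with b | b <;>
      simp only [max_def] at e1 e2 <;> split_ifs at e1 e2 <;> linarith
    by_cases h0 : z.2.1 = 0
    · apply Quot.sound
      left
      exact ⟨Subtype.ext h0, Subtype.ext (ht ▸ h0)⟩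
    by_cases h1 : z.2.1 = 1
    · apply Quot.sound
      right
      exact ⟨Subtype.ext h1, Subtype.ext (ht ▸ h1)⟩
    have hzw : z = w := by
      refine Prod.ext (Subtype.ext (funext fun v => ?_)) (Subtype.ext ht)
      have hz := ((mem_indR _ _ _).1 z.1.2).2.1 v
      have hw := ((mem_indR _ _ _).1 w.1.2).2.1 v
      by_cases hv : v = p
      · rw [hz (by simp [hT, hv]), hw (by simp [hT, hv])]
      by_cases hv' : v = q
      · rw [hz (by simp [hT, hv']), hw (by simp [hT, hv'])]
      have e := hvv z v hv hv'
      rw [h, hvv w v hv hv', ← ht] at e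
      have z0 : 0 < z.2.1 := lt_of_le_of_ne z.2.2.1 (Ne.symm h0)
      have z1 : z.2.1 < 1 := lt_of_le_of_ne z.2.2.2 h1
      have : |1 - 2 * z.2.1| < 1 := abs_lt.2 ⟨by linarith, by linarith⟩
      exact (mul_left_cancel₀ (by linarith) e).symm
    rw [hzw]
  have hsurj : Function.Surjective F := by
    intro f
    obtain ⟨f0, fS, fI, f1⟩ := (mem_indR _ _ _).1 f.2
    have hs := sum_split hpq.ne f.1
    rw [f1] at hs
    set s := ∑ v, (if v = p then 0 else if v = q then 0 else f.1 v) with hsdef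
    have hnn : ∀ v, 0 ≤ (if v = p then 0 else if v = q then 0 else f.1 v) := by
      intro v; split_ifs
      · exact le_rfl
      · exact le_rfl
      · exact f0 v
    have s0 : 0 ≤ s := Finset.sum_nonneg fun v _ => hnn v
    have p0 := f0 p
    have q0 := f0 q
    have hprod := fI p q hpq
    let t : unitInterval := ⟨(1 - f.1 p + f.1 q) / 2, by constructor <;> linarith⟩
    have htv : t.1 = (1 - f.1 p + f.1 q) / 2 := rfl
    have eP : max 0 (1 - 2 * t.1) = f.1 p := by
      rw [htv]
      rcases hprod with h | h <;> rw [h] at *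
      · exact max_eq_left (by linarith)
      · rw [max_eq_right (by linarith)]; ring
    have eQ : max 0 (2 * t.1 - 1) = f.1 q := by
      rw [htv]
      rcases hprod with h | h <;> rw [h] at *
      · rw [max_eq_right (by linarith)]; ring
      · exact max_eq_left (by linarith)
    have eS : 1 - |1 - 2 * t.1| = s := by
      have : 1 - 2 * t.1 = f.1 p - f.1 q := by rw [htv]; ring
      rw [this]
      rcases hprod with h | h
      · rw [abs_of_nonpos (by linarith)]; linarith
      · rw [abs_of_nonneg (by linarith)]; linarith
    have main : ∀ x : indRealizationIn G T, (∀ v, v ≠ p → v ≠ q → s * x.1 v = f.1 v) →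
        ∃ a, F a = f := by
      intro x hx
      refine ⟨Quot.mk _ (x, t), Subtype.ext (funext fun v => ?_)⟩
      rw [hval]
      by_cases hv : v = p
      · rw [hv, hpv]; exact eP
      by_cases hv' : v = q
      · rw [hv', hqv]; exact eQ
      rw [hvv _ _ hv hv', ← hx v hv hv', eS]
    by_cases hs0 : s = 0
    · obtain ⟨x, hx⟩ := hne
      refine main ⟨x, hx⟩ fun v hv hv' => ?_
      rw [hs0, zero_mul]
      have := (Finset.sum_eq_zero_iff_of_nonneg fun v _ => hnn v).1 (hsdef.symm.trans hs0) v
        (Finset.mem_univ v)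
      simpa [hv, hv'] using this.symm
    · refine main ⟨fun v => (if v = p then 0 else if v = q then 0 else f.1 v) / s, ?_⟩ ?_
      · rw [mem_indR]
        refine ⟨fun v => div_nonneg (hnn v) s0, fun v hv => ?_, fun a b hab => ?_, ?_⟩
        · by_cases hvp : v = p
          · simp [hvp]
          by_cases hvq : v = q
          · simp [hvq]
          have : f.1 v = 0 := by
            refine fS v fun h => hv ⟨h.1, hvp, hvq, h.2.resolve_left hvp⟩
          simp [this]
        · rcases fI a b hab with h | h
          · left; simp [h]
          · right; simp [h]
        · rw [← Finset.sum_div]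
          exact div_self hs0
      · intro v hv hv'
        simp only [hv, hv', if_false]
        field_simp
  haveI : CompactSpace (indRealizationIn G T) := isCompact_iff_compactSpace.1 (indR_compact G T)
  haveI : CompactSpace (Susp (indRealizationIn G T)) := by
    unfold Susp
    exact Quot.compactSpace
  exact ⟨Continuous.homeoOfEquivCompactToT2 (f := Equiv.ofBijective F ⟨hinj, hsurj⟩) hF⟩

end fold

theorem indR_reindex {V W : Type*} [Fintype V] [Fintype W] (G : SimpleGraph V)
    (H : SimpleGraph W) (e : V → W) (he : Function.Injective e) (S : Set V) (T : Set W)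
    (hT : ∀ w ∈ T, ∃ v ∈ S, e v = w) (hS : ∀ v ∈ S, e v ∈ T)
    (hadj : ∀ a ∈ S, ∀ b ∈ S, (H.Adj (e a) (e b) ↔ G.Adj a b)) :
    Nonempty (indRealizationIn H T ≃ₜ indRealizationIn G S) := by
  classical
  have hsum : ∀ g : W → ℝ, (∀ w, (¬ ∃ v, e v = w) → g w = 0) → ∑ w, g w = ∑ v, g (e v) := by
    intro g hg
    symm
    refine Fintype.sum_of_injective e he _ _ ?_ fun _ => rfl
    intro w hw
    exact hg w (by simpa using hw)
  have hST : ∀ v, e v ∈ T → v ∈ S := by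
    intro v hv
    obtain ⟨v', h, h'⟩ := hT _ hv
    rwa [← he h']
  have m1 : ∀ f ∈ indRealizationIn H T, f ∘ e ∈ indRealizationIn G S := by
    intro f hf
    rw [mem_indR] at hf ⊢
    obtain ⟨f0, fS, fI, f1⟩ := hf
    refine ⟨fun v => f0 _, fun v hv => fS _ fun h => hv (hST v h), fun a b hab => ?_, ?_⟩
    · by_cases ha : a ∈ S
      · by_cases hb : b ∈ S
        · exact fI _ _ ((hadj a ha b hb).2 hab)
        · exact Or.inr (fS _ fun h => hb (hST _ h))
      · exact Or.inl (fS _ fun h => ha (hST _ h))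
    · rw [← f1, hsum f]
      · rfl
      · intro w hw
        refine fS w fun h => hw ?_
        obtain ⟨v, _, h⟩ := hT w h
        exact ⟨v, h⟩
  have m2 : ∀ x ∈ indRealizationIn G S, Function.extend e x 0 ∈ indRealizationIn H T := by
    intro x hx
    rw [mem_indR] at hx ⊢
    obtain ⟨f0, fS, fI, f1⟩ := hx
    have hz : ∀ w, w ∉ T → Function.extend e x 0 w = 0 := by
      intro w hw
      by_cases h : ∃ v, e v = w
      · obtain ⟨v, rfl⟩ := h
        rw [he.extend_apply]
        exact fS v fun h => hw (hS v h)
      · rw [Function.extend_apply' _ _ _ h]; rfl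
    refine ⟨fun w => ?_, hz, fun a b hab => ?_, ?_⟩
    · by_cases h : ∃ v, e v = w
      · obtain ⟨v, rfl⟩ := h
        rw [he.extend_apply]
        exact f0 v
      · rw [Function.extend_apply' _ _ _ h]; exact le_rfl
    · by_cases ha : a ∈ T
      · by_cases hb : b ∈ T
        · obtain ⟨a, ha', rfl⟩ := hT a ha
          obtain ⟨b, hb', rfl⟩ := hT b hb
          rw [he.extend_apply, he.extend_apply]
          exact fI a b ((hadj a ha' b hb').1 hab)
        · exact Or.inr (hz b hb)
      · exact Or.inl (hz a ha)
    · rw [← f1, hsum]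
      · simp only [he.extend_apply]
      · intro w hw
        rw [Function.extend_apply' _ _ _ hw]; rfl
  refine ⟨⟨⟨fun f => ⟨f.1 ∘ e, m1 _ f.2⟩, fun x => ⟨Function.extend e x.1 0, m2 _ x.2⟩, ?_, ?_⟩,
    ?_, ?_⟩⟩
  · intro f
    apply Subtype.ext
    funext w
    change Function.extend e (f.1 ∘ e) 0 w = f.1 w
    by_cases h : ∃ v, e v = w
    · obtain ⟨v, rfl⟩ := h
      rw [he.extend_apply]; rfl
    · rw [Function.extend_apply' _ _ _ h]
      refine (((mem_indR _ _ _).1 f.2).2.1 w fun h' => h ?_).symm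
      obtain ⟨v, _, h⟩ := hT w h'
      exact ⟨v, h⟩
  · intro x
    apply Subtype.ext
    funext v
    exact he.extend_apply _ _ _
  · refine Continuous.subtype_mk ?_ _
    exact continuous_pi fun v => (continuous_apply (e v)).comp continuous_subtype_val
  · refine Continuous.subtype_mk ?_ _
    refine continuous_pi fun w => ?_
    by_cases h : ∃ v, e v = w
    · obtain ⟨v, rfl⟩ := h
      simp only [he.extend_apply]
      exact (continuous_apply v).comp continuous_subtype_val
    · simp only [Function.extend_apply' _ _ _ h]
      exact continuous_const

theorem hexRow_adj (n : ℕ) (a b : Fin 2 × Fin (2 * n + 1)) : (hexRow n).Adj a b ↔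
    (a.1 = b.1 ∧ ((a.2 : ℕ) + 1 = b.2 ∨ (b.2 : ℕ) + 1 = a.2)) ∨
    (a.1 ≠ b.1 ∧ (a.2 : ℕ) = b.2 ∧ (a.2 : ℕ) % 2 = 0) := by
  obtain ⟨i, j⟩ := a
  obtain ⟨i', j'⟩ := b
  simp only [hexRow, SimpleGraph.fromRel_adj, ne_eq, Prod.mk.injEq, Fin.ext_iff]
  omega

theorem mem_Xset (n : ℕ) (a : Fin 2 × Fin (2 * n + 1)) :
    a ∈ (insert (hexTop n) ((hexRow n).neighborSet (hexTop n)))ᶜ ↔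
    (a.1 : ℕ) + 2 * n ≥ a.2 + 2 - (a.1 : ℕ) + (a.1 : ℕ) := by
  obtain ⟨i, j⟩ := a
  simp only [mem_compl_iff, mem_insert_iff, SimpleGraph.mem_neighborSet, hexRow_adj, hexTop,
    Prod.mk.injEq, Fin.ext_iff, ne_eq, Fin.val_zero]
  omega

theorem Xn2_nonempty (k : ℕ) (hk : 1 ≤ k) : (Xn2 k).Nonempty := by
  classical
  refine ⟨Pi.single (0, ⟨0, by omega⟩) 1, ?_⟩
  unfold Xn2
  rw [mem_indR]
  refine ⟨fun v => ?_, fun v hv => ?_, fun a b hab => ?_, ?_⟩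
  · rw [Pi.single_apply]; split_ifs <;> norm_num
  · rw [Pi.single_apply, if_neg]
    rintro rfl
    apply hv
    rw [mem_Xset]
    simp
    omega
  · by_cases ha : a = (0, ⟨0, by omega⟩)
    · right
      rw [Pi.single_apply, if_neg]
      rintro rfl
      exact hab.ne ha
    · left
      rw [Pi.single_apply, if_neg ha]
  · rw [Finset.sum_pi_single']
    simp

theorem Xn2_step (k : ℕ) (hk : 1 ≤ k) :
    Nonempty (ContinuousMap.HomotopyEquiv (Xn2 (k + 1)) (Susp (Xn2 k))) := by
  set S := (insert (hexTop (k+1)) ((hexRow (k+1)).neighborSet (hexTop (k+1))))ᶜ with hS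
  let p : Fin 2 × Fin (2 * (k + 1) + 1) := (1, ⟨2 * k + 1, by omega⟩)
  let q : Fin 2 × Fin (2 * (k + 1) + 1) := (1, ⟨2 * k, by omega⟩)
  have hp : p ∈ S := by rw [hS, mem_Xset]; simp [p]; omega
  have hq : q ∈ S := by rw [hS, mem_Xset]; simp [q]; omega
  have hpq : (hexRow (k+1)).Adj p q := by rw [hexRow_adj]; simp [p, q]
  have hN : ∀ w ∈ S, (hexRow (k+1)).Adj p w → w = q := by
    rintro ⟨i, j⟩ hw h
    rw [hS, mem_Xset] at hw
    rw [hexRow_adj] at h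
    simp only [p, q, Prod.mk.injEq, Fin.ext_iff, Fin.val_one, ne_eq] at hw h ⊢
    omega
  let e : Fin 2 × Fin (2 * k + 1) → Fin 2 × Fin (2 * (k + 1) + 1) := fun a =>
    (a.1.rev, ⟨a.2, by omega⟩)
  have hr : ∀ i : Fin 2, (i.rev : ℕ) = 1 - i := by intro i; rw [Fin.val_rev]; omega
  have he : Function.Injective e := by
    rintro ⟨i, j⟩ ⟨i', j'⟩ h
    simp only [e, Prod.mk.injEq, Fin.ext_iff, hr] at h ⊢
    omega
  obtain ⟨h3⟩ := indR_reindex (hexRow k) (hexRow (k+1)) e he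
    ((insert (hexTop k) ((hexRow k).neighborSet (hexTop k)))ᶜ)
    {v | v ∈ S ∧ v ≠ p ∧ v ≠ q ∧ ¬ (hexRow (k+1)).Adj q v}
    (by
      rintro ⟨i, j⟩ ⟨h1, h2, h3, h4⟩
      rw [hS, mem_Xset] at h1
      rw [hexRow_adj] at h4
      simp only [p, q, ne_eq, Prod.mk.injEq, Fin.ext_iff, Fin.val_one] at h1 h2 h3 h4
      refine ⟨(i.rev, ⟨j, by omega⟩), ?_, ?_⟩
      · rw [mem_Xset]
        simp only [hr]
        omega
      · simp [e])
    (by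
      rintro ⟨i, j⟩ h
      rw [mem_Xset] at h
      rw [mem_setOf_eq, hS, mem_Xset, hexRow_adj]
      simp only [e, p, q, ne_eq, Prod.mk.injEq, Fin.ext_iff, Fin.val_one, hr] at h ⊢
      omega)
    (by
      rintro ⟨i, j⟩ _ ⟨i', j'⟩ _
      rw [hexRow_adj, hexRow_adj]
      simp only [e, ne_eq, Fin.ext_iff, hr]
      omega)
  have hne : (indRealizationIn (hexRow (k+1))
      {v | v ∈ S ∧ v ≠ p ∧ v ≠ q ∧ ¬ (hexRow (k+1)).Adj q v}).Nonempty := by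
    obtain ⟨x, hx⟩ := Xn2_nonempty k hk
    exact ⟨_, (h3.symm ⟨x, hx⟩).2⟩
  obtain ⟨h1⟩ := foldEquiv (hexRow (k+1)) S p q hp hpq hN
  obtain ⟨h2⟩ := joinHomeo (hexRow (k+1)) S p q hp hq hpq hN hne
  exact ⟨h1.trans (h2.symm.toHomotopyEquiv.trans (suspEquiv h3.toHomotopyEquiv))⟩

theorem Xn2_base : Nonempty (ContinuousMap.HomotopyEquiv (Xn2 1) (sphere' 1)) := by
  classical
  let c : Fin 2 × Fin (2 * 1 + 1) := (1, 0)
  let d : Fin 2 × Fin (2 * 1 + 1) := (1, 1)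
  have hcd : (hexRow 1).Adj c d := by rw [hexRow_adj]; simp [c, d]
  have hdc : d ≠ c := hcd.ne'
  have hS : ∀ v : Fin 2 × Fin (2 * 1 + 1),
      v ∈ (insert (hexTop 1) ((hexRow 1).neighborSet (hexTop 1)))ᶜ ↔
      v = c ∨ v = d ∨ v = (0, 0) := by
    rintro ⟨i, j⟩
    rw [mem_Xset]
    simp only [c, d, Prod.mk.injEq, Fin.ext_iff]
    simp
    omega
  have hadj : (hexRow 1).Adj c (0, 0) := by rw [hexRow_adj]; simp [c]
  have hnadj : ¬ (hexRow 1).Adj d (0, 0) := by rw [hexRow_adj]; simp [d]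
  have hsp : ∀ x : EuclideanSpace ℝ (Fin 1), x ∈ sphere' 1 ↔ x 0 = 1 ∨ x 0 = -1 := by
    intro x
    unfold sphere'
    rw [mem_sphere_zero_iff_norm, EuclideanSpace.norm_eq]
    simp [Real.sqrt_sq_eq_abs]
    exact abs_eq zero_le_one
  -- values at c
  have hc : ∀ f ∈ Xn2 1, f c = 0 ∨ (f c = 1 ∧ ∀ v, v ≠ c → f v = 0) := by
    intro f hf
    obtain ⟨f0, fS, fI, f1⟩ := (mem_indR _ _ _).1 hf
    by_cases h : f c = 0
    · exact Or.inl h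
    · right
      have : ∀ v, v ≠ c → f v = 0 := by
        intro v hv
        by_cases hvS : v ∈ (insert (hexTop 1) ((hexRow 1).neighborSet (hexTop 1)))ᶜ
        · rcases (hS v).1 hvS with rfl | rfl | rfl
          · exact absurd rfl hv
          · exact (fI _ _ hcd).resolve_left h
          · exact (fI _ _ hadj).resolve_left h
        · exact fS v hvS
      refine ⟨?_, this⟩
      rw [← f1, Finset.sum_eq_single c]
      · intro v _ hv; exact this v hv
      · simp
  let φ : C(Xn2 1, sphere' 1) := ⟨fun f => ⟨WithLp.toLp 2 fun _ => 1 - 2 * f.1 c, by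
      rw [hsp]
      rcases hc f.1 f.2 with h | h
      · left; simp [h]
      · right; simp [h.1]; norm_num⟩, by
    refine Continuous.subtype_mk ?_ _
    have : Continuous fun f : Xn2 1 => f.1 c := (continuous_apply c).comp continuous_subtype_val
    refine (PiLp.continuous_toLp 2 _).comp (continuous_pi fun _ => ?_)
    exact continuous_const.sub (continuous_const.mul this)⟩
  let g : ℝ → (Fin 2 × Fin (2 * 1 + 1) → ℝ) := fun y v =>
    if v = c then (1 - y) / 2 else if v = d then (1 + y) / 2 else 0
  have hg : ∀ y, (y = 1 ∨ y = -1) → g y ∈ Xn2 1 := by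
    intro y hy
    unfold Xn2
    rw [mem_indR]
    refine ⟨fun v => ?_, fun v hv => ?_, fun a b hab => ?_, ?_⟩
    · simp only [g]
      rcases hy with rfl | rfl <;> split_ifs <;> norm_num
    · have h1 : v ≠ c := fun h => hv ((hS v).2 (Or.inl h))
      have h2 : v ≠ d := fun h => hv ((hS v).2 (Or.inr (Or.inl h)))
      simp [g, h1, h2]
    · have hne := hab.ne
      simp only [g]
      rcases hy with rfl | rfl
      · by_cases ha : a = d
        · right; rw [ha] at hne; simp [Ne.symm hne]
        · left; simp [ha]
      · by_cases ha : a = c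
        · right; rw [ha] at hne; simp [Ne.symm hne]
        · left; simp [ha]
    · rw [sum_split hdc.symm]
      have : ∀ v, (if v = c then (0 : ℝ) else if v = d then 0 else g y v) = 0 := by
        intro v
        simp only [g]
        split_ifs <;> rfl
      rw [Finset.sum_eq_zero fun v _ => this v]
      simp only [g, hdc, if_true, if_false]
      ring
  let ψ : C(sphere' 1, Xn2 1) := ⟨fun x => ⟨g (x.1 0), hg _ ((hsp _).1 x.2)⟩, by
    refine Continuous.subtype_mk (continuous_pi fun v => ?_) _
    have : Continuous fun x : sphere' 1 => x.1 0 :=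
      (EuclideanSpace.proj (𝕜 := ℝ) (0 : Fin 1)).continuous.comp continuous_subtype_val
    simp only [g]
    split_ifs <;> fun_prop⟩
  refine ⟨⟨φ, ψ, ?_, ?_⟩⟩
  · symm
    refine lineHomotopic _ _ fun f t h0 h1 => ?_
    have hf := f.2
    change (1 - t) • f.1 + t • g (1 - 2 * f.1 c) ∈ Xn2 1
    rcases hc f.1 f.2 with h | h
    · have hm : g 1 ∈ Xn2 1 := hg 1 (Or.inl rfl)
      rw [h]
      simp only [mul_zero, sub_zero]
      unfold Xn2 at hf hm ⊢
      rw [mem_indR] at hf hm ⊢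
      have gz : ∀ v, v ≠ d → g 1 v = 0 := by intro v hv; simp [g, hv]
      refine ⟨fun v => ?_, fun v hv => ?_, fun a b hab => ?_, ?_⟩
      · have a1 := hf.1 v
        have a2 := hm.1 v
        have : 0 ≤ 1 - t := by linarith
        simp only [Pi.add_apply, Pi.smul_apply, smul_eq_mul]
        positivity
      · simp [hf.2.1 v hv, hm.2.1 v hv]
      · have kd : ∀ b, (hexRow 1).Adj d b → f.1 b = 0 ∧ g 1 b = 0 := by
          intro b hb
          refine ⟨?_, gz b hb.ne'⟩
          by_cases hbS : b ∈ (insert (hexTop 1) ((hexRow 1).neighborSet (hexTop 1)))ᶜ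
          · rcases (hS b).1 hbS with rfl | rfl | rfl
            · exact h
            · exact absurd rfl hb.ne
            · exact absurd hb hnadj
          · exact hf.2.1 b hbS
        by_cases ha : a = d
        · right
          have := kd b (ha ▸ hab)
          simp [this.1, this.2]
        by_cases hb : b = d
        · left
          have := kd a (hb ▸ hab.symm)
          simp [this.1, this.2]
        rcases hf.2.2.1 a b hab with h' | h'
        · left; simp [h', gz a ha]
        · right; simp [h', gz b hb]
      · simp only [Pi.add_apply, Pi.smul_apply, smul_eq_mul]
        rw [Finset.sum_add_distrib, ← Finset.mul_sum, ← Finset.mul_sum, hf.2.2.2, hm.2.2.2]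
        ring
    · have : g (1 - 2 * f.1 c) = f.1 := by
        funext v
        simp only [g, h.1]
        by_cases hv : v = c
        · rw [hv, h.1]; simp
        · rw [h.2 v hv]; simp [hv]; intro; norm_num
      rw [this, ← add_smul]
      simpa using hf
  · have : φ.comp ψ = ContinuousMap.id _ := by
      apply ContinuousMap.ext
      intro x
      apply Subtype.ext
      ext i
      obtain rfl : i = 0 := Subsingleton.elim _ _
      change 1 - 2 * g (x.1 0) c = x.1 0
      simp [g]
      ring
    rw [this]

/-- for `n ≥ 2`, `Ind (X_{n+1}^{(2)}) ≃ Σ² (Ind (X_{n-1}^{(2)}))`,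
with base case `Ind (X_1^{(2)}) ≃ S^0`. -/
theorem ind_Xn2_susp (n : ℕ) (hn : 2 ≤ n) :
    Nonempty (ContinuousMap.HomotopyEquiv (↥(Xn2 (n + 1)))
      (Susp (Susp (↥(Xn2 (n - 1)))))) ∧
    Nonempty (ContinuousMap.HomotopyEquiv (↥(Xn2 1)) (↥(sphere' 1))) := by
  refine ⟨?_, Xn2_base⟩
  obtain ⟨m, rfl⟩ : ∃ m, n = m + 1 := ⟨n - 1, by omega⟩
  obtain ⟨h1⟩ := Xn2_step (m + 1) (by omega)
  obtain ⟨h2⟩ := Xn2_step m (by omega)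
  exact ⟨h1.trans (suspEquiv h2)⟩
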